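/- Let G be a complete normed abelian group. Suppose there exist real numbers a < b and a nonconstant continuous path γ : [a,b] → G of finite length. Then there exists a compactly supported G-valued Borel measure ν on ℝ with finite total variation such that ν(S) ≠ 0 for some Borel set S, yet ν(C) = 0 for every countable Borel set C; in particular ν is not purely atomic. (This is the construction proving the implication (1) ⟹ (2) of Theorem 7.1 in the 0-dimensional case.) -/

import Mathlib

open MeasureTheory Set

/-- A `G`-valued vector measure has finite total variation: there is `C < ∞` such that
`∑ᵢ ‖ν(Sᵢ)‖ ≤ C` for every countable family of pairwise disjoint Borel sets. -/
def HasFiniteTotalVariation {X : Type*} [MeasurableSpace X] {G : Type*} [NormedAddCommGroup G]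
    (ν : VectorMeasure X G) : Prop :=
  ∃ C : ℝ, ∀ S : ℕ → Set X, (∀ i, MeasurableSet (S i)) →
    Pairwise (Function.onFun Disjoint S) →
    ∀ n : ℕ, ∑ i ∈ Finset.range n, ‖ν (S i)‖ ≤ C

/-- `ν` is compactly supported: there is a compact `K` with `ν B = 0` for every
Borel `B` disjoint from `K`. -/
def CompactlySupported {X : Type*} [MeasurableSpace X] [TopologicalSpace X]
    {G : Type*} [NormedAddCommGroup G] (ν : VectorMeasure X G) : Prop :=
  ∃ K : Set X, IsCompact K ∧ ∀ B : Set X, MeasurableSet B → Disjoint B K → ν B = 0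

/-- `ν` is purely atomic: there is a countable set `S` with `ν (B \ S) = 0` for every
Borel `B`. -/
def PurelyAtomic {X : Type*} [MeasurableSpace X] {G : Type*} [NormedAddCommGroup G]
    (ν : VectorMeasure X G) : Prop :=
  ∃ S : Set X, S.Countable ∧ ∀ B : Set X, MeasurableSet B → ν (B \ S) = 0

/-- `γ` has finite length on `[a, b]`: the sums `∑ ‖γ(tᵢ₊₁) - γ(tᵢ)‖` over all partitions
`a = t₀ ≤ t₁ ≤ ⋯ ≤ t_m = b` are bounded. -/
def FiniteLengthOn {G : Type*} [NormedAddCommGroup G] (γ : ℝ → G) (a b : ℝ) : Prop :=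
  ∃ C : ℝ, ∀ (m : ℕ) (t : ℕ → ℝ), Monotone t → t 0 = a → t m = b →
    ∑ i ∈ Finset.range m, ‖γ (t (i + 1)) - γ (t i)‖ ≤ C

/-- A path of finite length on `[a, b]` has bounded variation there. -/
theorem FiniteLengthOn.boundedVariationOn {G : Type*} [NormedAddCommGroup G] {γ : ℝ → G} {a b : ℝ}
    (h : FiniteLengthOn γ a b) : BoundedVariationOn γ (Icc a b) := by
  obtain ⟨C, hC⟩ := h
  refine ((iSup_le fun p ↦ ?_).trans_lt (ENNReal.ofReal_lt_top (r := C))).ne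
  obtain ⟨n, u, hu, hmem⟩ := p
  let t : ℕ → ℝ := fun i ↦ if i = 0 then a else if i ≤ n + 1 then u (i - 1) else b
  have ht : Monotone t := by
    refine monotone_nat_of_le_succ fun i ↦ ?_
    have h₁ := hmem (i - 1)
    have h₂ := hmem i
    have h₃ := hu (Nat.sub_le i 1)
    simp only [t, mem_Icc] at *
    grind
  have key := hC (n + 2) t ht (by simp [t]) (by simp [t])
  have hsum : ∑ i ∈ Finset.range n, ‖γ (u (i + 1)) - γ (u i)‖ ≤ C := by
    rw [Finset.sum_range_succ, Finset.sum_range_succ'] at key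
    have : ∑ i ∈ Finset.range n, ‖γ (t (i + 1 + 1)) - γ (t (i + 1))‖ =
        ∑ i ∈ Finset.range n, ‖γ (u (i + 1)) - γ (u i)‖ := by
      refine Finset.sum_congr rfl fun i hi ↦ ?_
      have := Finset.mem_range.1 hi
      simp [t, this.le, Nat.succ_le_of_lt this]
    have h₁ := norm_nonneg (γ (t (0 + 1)) - γ (t 0))
    have h₂ := norm_nonneg (γ (t (n + 1 + 1)) - γ (t (n + 1)))
    linarith
  simp only [edist_dist, dist_eq_norm]
  rw [← ENNReal.ofReal_sum_of_nonneg fun _ _ ↦ norm_nonneg _]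
  exact ENNReal.ofReal_le_ofReal hsum

/-- A continuous function of bounded variation on `ℝ` has a Stieltjes vector measure dominated by
a finite measure. -/
theorem BoundedVariationOn.exists_vectorMeasure_le_measure {E : Type*} [NormedAddCommGroup E]
    [CompleteSpace E] {f : ℝ → E} (hf : BoundedVariationOn f univ) (hc : Continuous f) :
    ∃ (m : VectorMeasure ℝ E) (μ : Measure ℝ), IsFiniteMeasure μ ∧
      (∀ u v, u ≤ v → m (Ioc u v) = f v - f u) ∧ ∀ s, ‖m s‖ₑ ≤ μ s := by
  have hlim : f.rightLim = f := funext fun x ↦ hc.continuousWithinAt.rightLim_eq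
  let μ := (hf.stieltjesFunctionRightLim 0).measure
  have hμ : IsFiniteMeasure μ :=
    StieltjesFunction.isFiniteMeasure_of_forall_abs_le (C := (eVariationOn f.rightLim univ).toReal)
      _ fun x ↦ variationOnFromTo.abs_le_eVariationOn hf.rightLim
  let c := AddContent.onIoc f
  have hle : ∀ s ∈ {s | ∃ u v, u ≤ v ∧ s = Ioc u v}, ‖c s‖ₑ ≤ μ s := by
    rintro s ⟨u, v, huv, rfl⟩
    rw [AddContent.onIoc_apply huv]
    simp only [μ, StieltjesFunction.measure_Ioc,
      BoundedVariationOn.stieltjesFunctionRightLim_apply, hlim]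
    rw [← variationOnFromTo.add hf.locallyBoundedVariationOn (mem_univ 0) (mem_univ u)
      (mem_univ v), add_sub_cancel_left, variationOnFromTo.eq_of_le _ _ huv,
      ENNReal.ofReal_toReal (hf.mono (subset_univ _)), ← edist_eq_enorm_sub]
    exact eVariationOn.edist_le _ (by grind) (by grind)
  have hgen : (inferInstance : MeasurableSpace ℝ) =
      MeasurableSpace.generateFrom {s | ∃ u v, u ≤ v ∧ s = Ioc u v} := by
    rw [BorelSpace.measurable_eq (α := ℝ)]
    convert! borel_eq_generateFrom_Ioc_le ℝ using 2
    grind only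
  obtain ⟨m, hm, hmμ⟩ :=
    VectorMeasure.exists_extension_of_isSetSemiring_of_le_measure_of_generateFrom
      IsSetSemiring.Ioc hle hgen
  exact ⟨m, μ, hμ, fun u v huv ↦ (hm _ ⟨u, v, huv, rfl⟩).trans (AddContent.onIoc_apply huv), hmμ⟩

/-- A vector measure dominated by a finite measure has finite total variation. -/
theorem HasFiniteTotalVariation.of_enorm_le {X : Type*} [MeasurableSpace X] {G : Type*}
    [NormedAddCommGroup G] {ν : VectorMeasure X G} (μ : Measure X) [IsFiniteMeasure μ]
    (h : ∀ s, MeasurableSet s → ‖ν s‖ₑ ≤ μ s) : HasFiniteTotalVariation ν := by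
  refine ⟨μ.real univ, fun S hS hd n ↦ ?_⟩
  calc ∑ i ∈ Finset.range n, ‖ν (S i)‖
      ≤ ∑ i ∈ Finset.range n, μ.real (S i) := Finset.sum_le_sum fun i _ ↦ by
        rw [← toReal_enorm]
        exact ENNReal.toReal_mono (measure_ne_top μ _) (h _ (hS i))
    _ = μ.real (⋃ i ∈ Finset.range n, S i) :=
        (measureReal_biUnion_finset (fun i _ j _ hij ↦ hd hij) fun i _ ↦ hS i).symm
    _ ≤ μ.real univ := measureReal_mono (subset_univ _)

/-- A vector measure giving mass `f v - f u` to `(u, v]`, with `f` continuous, has no atoms. -/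
theorem MeasureTheory.VectorMeasure.singleton_eq_zero_of_Ioc {E : Type*} [NormedAddCommGroup E]
    {m : VectorMeasure ℝ E} {f : ℝ → E} (hc : Continuous f)
    (hm : ∀ u v, u ≤ v → m (Ioc u v) = f v - f u) (x : ℝ) : m {x} = 0 := by
  obtain ⟨u, u_mono, u_lt, u_lim⟩ := exists_seq_strictMono_tendsto x
  have hinter : {x} = ⋂ n, Ioc (u n) x := by
    refine Subset.antisymm (fun y hy ↦ by simp [mem_singleton_iff.1 hy, u_lt]) fun y hy ↦ ?_
    have hy' : ∀ i, u i < y ∧ y ≤ x := by simpa using hy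
    exact le_antisymm (hy' 0).2 (le_of_tendsto' u_lim fun n ↦ (hy' n).1.le)
  have h₁ : Filter.Tendsto (fun n ↦ m (Ioc (u n) x)) Filter.atTop (nhds (m {x})) := by
    rw [hinter]
    exact VectorMeasure.tendsto_vectorMeasure_iInter_atTop_nat
      (fun i j hij ↦ Ioc_subset_Ioc_left (u_mono.monotone hij)) fun n ↦ measurableSet_Ioc
  have h₂ : Filter.Tendsto (fun n ↦ m (Ioc (u n) x)) Filter.atTop (nhds (f x - f x)) := by
    simp_rw [hm _ _ (u_lt _).le]
    exact tendsto_const_nhds.sub ((hc.tendsto x).comp u_lim)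
  rw [tendsto_nhds_unique h₁ h₂, sub_self]

/-- A vector measure vanishing on singletons vanishes on countable sets. -/
theorem MeasureTheory.VectorMeasure.eq_zero_of_countable {X : Type*} [MeasurableSpace X]
    [MeasurableSingletonClass X] {E : Type*} [AddCommMonoid E] [TopologicalSpace E] [T2Space E]
    {m : VectorMeasure X E} (hm : ∀ x, m {x} = 0) {C : Set X} (hC : C.Countable) : m C = 0 := by
  have := hC.to_subtype
  have hU : C = ⋃ x : C, {(x : X)} := by simp
  rw [hU, m.of_disjoint_iUnion (fun _ ↦ measurableSet_singleton _)
    fun x y hxy ↦ disjoint_singleton.2 fun h ↦ hxy (Subtype.ext h)]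
  simp [hm]

/-- A nonzero vector measure vanishing on countable sets is not purely atomic. -/
theorem not_purelyAtomic {X : Type*} [MeasurableSpace X] [MeasurableSingletonClass X] {G : Type*}
    [NormedAddCommGroup G] {ν : VectorMeasure X G} (hν : ∀ C : Set X, C.Countable → ν C = 0)
    {B : Set X} (hB : MeasurableSet B) (hB₀ : ν B ≠ 0) : ¬ PurelyAtomic ν := by
  rintro ⟨S, hS, h⟩
  apply hB₀
  rw [← inter_union_sdiff B S, VectorMeasure.of_union
    (disjoint_sdiff_right.mono_left inter_subset_right) (hB.inter hS.measurableSet)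
    (hB.diff hS.measurableSet), h B hB, hν _ (hS.mono inter_subset_right), add_zero]

/-- The construction proving (1) ⟹ (2) of Theorem 7.1 in the 0-dimensional case:
from a nonconstant continuous path `γ : [a,b] → G` of finite length one obtains a
compactly supported `G`-valued Borel measure `ν` on `ℝ` of finite total variation
that is nonzero on some Borel set but vanishes on every countable Borel set; in
particular `ν` is not purely atomic. -/
theorem exists_nonatomic_measure_of_finite_length_path
    {G : Type*} [NormedAddCommGroup G] [CompleteSpace G]
    (a b : ℝ) (hab : a < b) (γ : ℝ → G) (hc : ContinuousOn γ (Icc a b))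
    (hfin : FiniteLengthOn γ a b)
    (hnc : ∃ s ∈ Icc a b, ∃ t ∈ Icc a b, γ s ≠ γ t) :
    ∃ ν : VectorMeasure ℝ G, CompactlySupported ν ∧ HasFiniteTotalVariation ν ∧
      (∃ S : Set ℝ, MeasurableSet S ∧ ν S ≠ 0) ∧
      (∀ C : Set ℝ, C.Countable → ν C = 0) ∧
      ¬ PurelyAtomic ν := by
  let f : ℝ → G := fun x ↦ γ (projIcc a b hab.le x)
  have hfγ : ∀ x ∈ Icc a b, f x = γ x := fun x hx ↦ by simp [f, projIcc_of_mem hab.le hx]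
  have hfc : Continuous f := hc.comp_continuous (by fun_prop) fun x ↦ (projIcc a b hab.le x).2
  have hfbv : BoundedVariationOn f univ := by
    refine ne_top_of_le_ne_top hfin.boundedVariationOn (eVariationOn.comp_le_of_monotoneOn γ
      (fun x ↦ (projIcc a b hab.le x : ℝ)) (fun x _ y _ hxy ↦ monotone_projIcc hab.le hxy)
      fun x _ ↦ (projIcc a b hab.le x).2)
  obtain ⟨m, μ, hμ, hm, hmμ⟩ := hfbv.exists_vectorMeasure_le_measure hfc
  have hcount : ∀ C : Set ℝ, C.Countable → m C = 0 := fun C ↦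
    VectorMeasure.eq_zero_of_countable (VectorMeasure.singleton_eq_zero_of_Ioc hfc hm)
  have hr : ∀ B, MeasurableSet B → m.restrict (Icc a b) B = m (B ∩ Icc a b) := fun B hB ↦
    VectorMeasure.restrict_apply m measurableSet_Icc hB
  have hrcount : ∀ C : Set ℝ, C.Countable → m.restrict (Icc a b) C = 0 := fun C hC ↦ by
    rw [hr C hC.measurableSet, hcount _ (hC.mono inter_subset_left)]
  obtain ⟨s, t, hs, ht, hst, hne⟩ : ∃ s t, s ∈ Icc a b ∧ t ∈ Icc a b ∧ s ≤ t ∧ γ s ≠ γ t := by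
    obtain ⟨s, hs, t, ht, hne⟩ := hnc
    rcases le_total s t with h | h
    · exact ⟨s, t, hs, ht, h, hne⟩
    · exact ⟨t, s, ht, hs, h, hne.symm⟩
  have hS : m.restrict (Icc a b) (Ioc s t) ≠ 0 := by
    rw [hr _ measurableSet_Ioc,
      inter_eq_left.2 (Ioc_subset_Icc_self.trans (Icc_subset_Icc hs.1 ht.2)), hm s t hst,
      hfγ s hs, hfγ t ht]
    exact sub_ne_zero.2 hne.symm
  refine ⟨m.restrict (Icc a b), ⟨Icc a b, isCompact_Icc, fun B hB hd ↦ ?_⟩,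
    .of_enorm_le μ fun B hB ↦ ?_, ⟨Ioc s t, measurableSet_Ioc, hS⟩, hrcount,
    not_purelyAtomic hrcount measurableSet_Ioc hS⟩
  · rw [hr B hB, hd.inter_eq, VectorMeasure.empty]
  · rw [hr B hB]
    exact (hmμ _).trans (measure_mono inter_subset_left)
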